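/- Let n ≥ 1 and let m ∈ ℕ with m < 2^n, and set k = Gm = m XOR ⌊m/2⌋ and m_0 = m mod 2. Then the diagonal entry of the cyclic translation operator on the Walsh function w_k satisfies 2^{−n} Σ_{j=0}^{2^n−1} w_k(((j−1) mod 2^n)/2^n) · w_k(j/2^n) = 1 − 2^{−n+1}(m + m_0). Consequently, the best approximation in Hilbert–Schmidt norm of the cyclic translation operator T_{2^{−n}} (given by (T g)(j) = g((j−1) mod 2^n)) by a dyadic convolution operator C_f has Walsh coefficients f^∼(Gm) = 1 − 2^{−n+1}(m + m_0) for all m < 2^n. -/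

import Mathlib

/-- The `j`-th binary digit (`j ≥ 1`) of `x ∈ [0,1)`, using the terminating binary
expansion `x = Σ_{j≥1} x_j 2^{-j}` (the expansion ending in zeros for dyadic rationals). -/
noncomputable def dyadicDigit (j : ℕ) (x : ℝ) : ℕ := (⌊x * 2 ^ j⌋).toNat % 2

/-- The Walsh–Paley function `w_k` on `[0,1)`: `w_k(x) = (-1) ^ (Σ_{i≥0} k_i x_{i+1})`,
where `k = Σ_i k_i 2^i` (all bits of `k` lie below `k + 1`). -/
noncomputable def walsh (k : ℕ) (x : ℝ) : ℝ :=
  (-1 : ℝ) ^ (∑ i ∈ Finset.range (k + 1), (k.testBit i).toNat * dyadicDigit (i + 1) x)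

/-- `lastOnePos n x`: the largest index `r ∈ {1,…,n}` with `r`-th binary digit of `x`
equal to `1` (the position of the last nonzero digit); by convention it is `1` for `x = 0`. -/
noncomputable def lastOnePos (n : ℕ) (x : ℝ) : ℕ :=
  if x = 0 then 1 else ((Finset.Icc 1 n).filter (fun r => dyadicDigit r x = 1)).sup id

/-- The Gray code map `G m = m XOR ⌊m/2⌋`. -/
def grayCode (m : ℕ) : ℕ := m ^^^ (m / 2)

/-- The Walsh vector `W_k ∈ ℂ^{2^n}`, `W_k(j) = w_k(j/2^n)`. -/
noncomputable def walshVec (n k : ℕ) : Fin (2 ^ n) → ℂ :=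
  fun j => ((walsh k ((j : ℝ) / 2 ^ n) : ℝ) : ℂ)

/-- Dyadic convolution on `ℂ^{2^n}`: `(f ∗ g)(j) = 2^{-n} Σ_t f(j XOR t) g(t)`. -/
noncomputable def dconv (n : ℕ) (f g : Fin (2 ^ n) → ℂ) : Fin (2 ^ n) → ℂ :=
  fun j => (2 ^ n : ℂ)⁻¹ *
    ∑ t : Fin (2 ^ n), f ⟨j.val ^^^ t.val, Nat.xor_lt_two_pow j.isLt t.isLt⟩ * g t

/-- The Walsh coefficients `f^∼(k) = 2^{-n} Σ_j f(j) w_k(j/2^n)` of `f ∈ ℂ^{2^n}`. -/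
noncomputable def walshCoeff (n : ℕ) (f : Fin (2 ^ n) → ℂ) (k : ℕ) : ℂ :=
  (2 ^ n : ℂ)⁻¹ * ∑ j : Fin (2 ^ n), f j * ((walsh k ((j : ℝ) / 2 ^ n) : ℝ) : ℂ)

/-- The normalized inner product `⟨u,v⟩ = 2^{-n} Σ_j u(j) conj(v(j))` on `ℂ^{2^n}`. -/
noncomputable def ninner (n : ℕ) (u v : Fin (2 ^ n) → ℂ) : ℂ :=
  (2 ^ n : ℂ)⁻¹ * ∑ j : Fin (2 ^ n), u j * (starRingEnd ℂ) (v j)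

/-- The squared Hilbert–Schmidt norm `Σ_λ ‖A e_λ‖²` of an operator `A` on `ℂ^{2^n}`,
computed with respect to the normalized inner product `ninner`, using the orthonormal
basis `e_j = 2^{n/2} δ_j` (so `‖A e_j‖² = 2^n ⟨A δ_j, A δ_j⟩`). -/
noncomputable def hsNormSq (n : ℕ) (A : (Fin (2 ^ n) → ℂ) → (Fin (2 ^ n) → ℂ)) : ℝ :=
  ∑ j : Fin (2 ^ n), (2 ^ n : ℝ) * (ninner n (A (Pi.single j 1)) (A (Pi.single j 1))).re

/-- The index `(j - 1) mod 2^n`. -/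
def predIdx (n : ℕ) (j : Fin (2 ^ n)) : Fin (2 ^ n) :=
  ⟨(j.val + (2 ^ n - 1)) % 2 ^ n, Nat.mod_lt _ (Nat.two_pow_pos n)⟩

/-- The index `(j + 1) mod 2^n`. -/
def succIdx (n : ℕ) (j : Fin (2 ^ n)) : Fin (2 ^ n) :=
  ⟨(j.val + 1) % 2 ^ n, Nat.mod_lt _ (Nat.two_pow_pos n)⟩

/-- The sign `w_k(j/2^n)` as a product over the binary digits, for `k < 2^n`. -/
def walshSign (n k j : ℕ) : ℝ :=
  ∏ i ∈ Finset.range n, if k.testBit i && j.testBit (n - 1 - i) then -1 else 1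

lemma dyadicDigit_div_two_pow {n i : ℕ} (hi : i < n) (j : ℕ) :
    dyadicDigit (i + 1) ((j : ℝ) / 2 ^ n) = (j.testBit (n - 1 - i)).toNat := by
  have hpow : (2 : ℝ) ^ n = 2 ^ (n - 1 - i) * 2 ^ (i + 1) := by
    rw [← pow_add]
    congr 1
    omega
  have hquot : (j : ℝ) / 2 ^ n * 2 ^ (i + 1) = (j : ℝ) / ((2 ^ (n - 1 - i) : ℕ) : ℝ) := by
    rw [hpow]
    push_cast
    field_simp
  rw [dyadicDigit, hquot, Int.floor_toNat, Nat.floor_div_eq_div, Nat.toNat_testBit]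

lemma walsh_div_two_pow {n k : ℕ} (hk : k < 2 ^ n) (j : ℕ) :
    walsh k ((j : ℝ) / 2 ^ n) = walshSign n k j := by
  have hbig : ∀ i, k + 1 ≤ i → k.testBit i = false := fun i hi =>
    Nat.testBit_lt_two_pow (lt_of_lt_of_le (by omega) (Nat.lt_two_pow_self (n := i)).le)
  have hbit : ∀ i, n ≤ i → k.testBit i = false := fun i hi =>
    Nat.testBit_lt_two_pow (hk.trans_le (Nat.pow_le_pow_right two_pos hi))
  rw [walsh, walshSign, ← Finset.prod_pow_eq_pow_sum]
  rw [Finset.prod_subset (Finset.range_mono (show k + 1 ≤ n + (k + 1) by omega)),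
    Finset.prod_subset (Finset.range_mono (show n ≤ n + (k + 1) by omega))]
  · refine Finset.prod_congr rfl fun i _ => ?_
    rcases lt_or_ge i n with hi | hi
    · rw [dyadicDigit_div_two_pow hi]
      cases k.testBit i <;> cases j.testBit (n - 1 - i) <;> simp
    · simp [hbit i hi]
  · intro i _ hi
    simp [hbit i (by simpa using hi)]
  · intro i _ hi
    simp [hbig i (by simpa using hi)]

lemma walshSign_mul_self (n k j : ℕ) : walshSign n k j * walshSign n k j = 1 := by
  rw [walshSign, ← Finset.prod_mul_distrib]
  refine Finset.prod_eq_one fun i _ => ?_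
  split_ifs <;> norm_num

lemma walshSign_xor (n k i j : ℕ) :
    walshSign n k (i ^^^ j) = walshSign n k i * walshSign n k j := by
  rw [walshSign, walshSign, walshSign, ← Finset.prod_mul_distrib]
  refine Finset.prod_congr rfl fun l _ => ?_
  rw [Nat.testBit_xor]
  cases k.testBit l <;> cases i.testBit (n - 1 - l) <;> cases j.testBit (n - 1 - l) <;> simp

lemma walshSign_congr {n k l : ℕ} (h : ∀ i < n, k.testBit i = l.testBit i) (j : ℕ) :
    walshSign n k j = walshSign n l j :=
  Finset.prod_congr rfl fun i hi => by rw [h i (Finset.mem_range.1 hi)]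

lemma walshSign_succ (n k j : ℕ) :
    walshSign (n + 1) k j =
      walshSign n k (j / 2) * if k.testBit n && j.testBit 0 then -1 else 1 := by
  rw [walshSign, Finset.prod_range_succ, walshSign]
  congr 1
  · refine Finset.prod_congr rfl fun i hi => ?_
    have hi := Finset.mem_range.1 hi
    rw [Nat.testBit_div_two, show n + 1 - 1 - i = n - 1 - i + 1 by omega]
  · simp

/-- The unnormalized diagonal entry of the cyclic translation on the `k`-th Walsh function. -/
def shiftCorr (n k : ℕ) : ℝ :=
  ∑ j ∈ Finset.range (2 ^ n), walshSign n k ((j + 2 ^ n - 1) % 2 ^ n) * walshSign n k j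

lemma shiftCorr_congr {n k l : ℕ} (h : ∀ i < n, k.testBit i = l.testBit i) :
    shiftCorr n k = shiftCorr n l := by
  simp only [shiftCorr, walshSign_congr h]

lemma sum_range_two_mul (F : ℕ → ℝ) (M : ℕ) :
    ∑ j ∈ Finset.range (2 * M), F j = ∑ j ∈ Finset.range M, (F (2 * j) + F (2 * j + 1)) := by
  induction M with
  | zero => simp
  | succ M ih =>
    rw [Nat.mul_succ, Finset.sum_range_succ, Finset.sum_range_succ, ih, Finset.sum_range_succ]
    ring

lemma shiftCorr_succ (n k : ℕ) :
    shiftCorr (n + 1) k = (if k.testBit n then -1 else 1) * (2 ^ n + shiftCorr n k) := by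
  have hpos : 0 < 2 ^ n := Nat.two_pow_pos n
  have hodd : ∀ j < 2 ^ n, (2 * j + 1 + 2 * 2 ^ n - 1) % (2 * 2 ^ n) = 2 * j := fun j hj => by
    rw [show 2 * j + 1 + 2 * 2 ^ n - 1 = 2 * j + 2 * 2 ^ n by omega, Nat.add_mod_right,
      Nat.mod_eq_of_lt (by omega)]
  have heven : ∀ j, (2 * j + 2 * 2 ^ n - 1) % (2 * 2 ^ n) = 2 * ((j + 2 ^ n - 1) % 2 ^ n) + 1 :=
    fun j => by
    have hlt := Nat.mod_lt (j + 2 ^ n - 1) hpos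
    have hdiv := Nat.div_add_mod (j + 2 ^ n - 1) (2 ^ n)
    have hsplit : 2 * j + 2 * 2 ^ n - 1 = (2 * ((j + 2 ^ n - 1) % 2 ^ n) + 1) +
        2 * 2 ^ n * ((j + 2 ^ n - 1) / 2 ^ n) := by
      rw [mul_assoc]
      omega
    rw [hsplit, Nat.add_mul_mod_self_left, Nat.mod_eq_of_lt (by omega)]
  rw [shiftCorr, pow_succ', sum_range_two_mul, shiftCorr, mul_add, Finset.mul_sum,
    Finset.sum_add_distrib, add_comm]
  congr 1
  · have hterm : ∀ j ∈ Finset.range (2 ^ n),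
        walshSign (n + 1) k ((2 * j + 1 + 2 * 2 ^ n - 1) % (2 * 2 ^ n)) *
          walshSign (n + 1) k (2 * j + 1) = if k.testBit n then -1 else 1 := fun j hj => by
      rw [hodd j (Finset.mem_range.1 hj), walshSign_succ, walshSign_succ,
        show 2 * j / 2 = j by omega, show (2 * j + 1) / 2 = j by omega]
      have hsq := walshSign_mul_self n k j
      cases k.testBit n <;> simp [hsq]
    rw [Finset.sum_congr rfl hterm]
    simp [mul_comm]
  · refine Finset.sum_congr rfl fun j _ => ?_
    rw [heven, walshSign_succ, walshSign_succ, show 2 * j / 2 = j by omega,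
      Nat.mul_add_div two_pos]
    cases k.testBit n <;> simp

lemma testBit_grayCode (m i : ℕ) :
    (grayCode m).testBit i = (m.testBit i ^^ m.testBit (i + 1)) := by
  rw [grayCode, Nat.testBit_xor, Nat.testBit_div_two]

lemma grayCode_lt {n m : ℕ} (hm : m < 2 ^ n) : grayCode m < 2 ^ n :=
  Nat.xor_lt_two_pow hm ((Nat.div_le_self m 2).trans_lt hm)

lemma shiftCorr_grayCode (n : ℕ) : ∀ m < 2 ^ n,
    shiftCorr n (grayCode m) = 2 ^ n - 2 * ((m : ℝ) + ((m % 2 : ℕ) : ℝ)) := by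
  induction n with
  | zero =>
    intro m hm
    obtain rfl : m = 0 := by simpa using hm
    simp [shiftCorr, walshSign]
  | succ n ih =>
    intro m hm
    have htop : (grayCode m).testBit n = m.testBit n := by
      rw [testBit_grayCode, Nat.testBit_lt_two_pow hm, Bool.xor_false]
    rw [shiftCorr_succ, htop]
    rcases lt_or_ge m (2 ^ n) with hlt | hge
    · rw [Nat.testBit_lt_two_pow hlt, ih m hlt]
      simp only [Bool.false_eq_true, if_false]
      ring
    · have hcompl : 2 ^ (n + 1) - (m + 1) < 2 ^ n := by
        rw [pow_succ'] at hm ⊢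
        omega
      have hcongr : shiftCorr n (grayCode m) =
          shiftCorr n (grayCode (2 ^ (n + 1) - (m + 1))) := by
        refine shiftCorr_congr fun i hi => ?_
        rw [testBit_grayCode, testBit_grayCode, Nat.testBit_two_pow_sub_succ hm,
          Nat.testBit_two_pow_sub_succ hm]
        simp [show i < n + 1 by omega, hi]
      have hbit : m.testBit n = true := by
        rw [Nat.testBit_eq_decide_div_mod_eq,
          Nat.div_eq_of_lt_le (k := 1) (by omega) (by rw [pow_succ'] at hm; omega)]
        simp
      have hsum : 2 ^ (n + 1) - (m + 1) + (2 ^ (n + 1) - (m + 1)) % 2 + (m + m % 2)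
          = 2 ^ (n + 1) := by
        rw [pow_succ'] at hm ⊢
        omega
      have hsumR : ((2 ^ (n + 1) - (m + 1) : ℕ) : ℝ) +
          (((2 ^ (n + 1) - (m + 1)) % 2 : ℕ) : ℝ) + ((m : ℝ) + ((m % 2 : ℕ) : ℝ))
          = 2 ^ (n + 1) := by
        exact_mod_cast hsum
      rw [hcongr, ih _ hcompl, hbit]
      simp only [if_true]
      have hpow : (2 : ℝ) ^ (n + 1) = 2 * 2 ^ n := pow_succ' 2 n
      linarith

lemma sum_normSq_sub {ι : Type*} [Fintype ι] (a : ι → ℂ) (z c : ℂ)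
    (hc : (Fintype.card ι : ℂ) * c = ∑ i, a i) :
    ∑ i, Complex.normSq (a i - z) =
      ∑ i, Complex.normSq (a i - c) + Fintype.card ι * Complex.normSq (z - c) := by
  have hzero : ∑ i, ((a i - c) * (starRingEnd ℂ) (z - c)).re = 0 := by
    rw [← Complex.re_sum, ← Finset.sum_mul, Finset.sum_sub_distrib, ← hc]
    simp
  have hterm : ∀ i, Complex.normSq (a i - z) = Complex.normSq (a i - c) +
      Complex.normSq (z - c) - 2 * ((a i - c) * (starRingEnd ℂ) (z - c)).re := fun i => by
    rw [← Complex.normSq_sub]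
    congr 1
    ring
  rw [Finset.sum_congr rfl fun i _ => hterm i, Finset.sum_sub_distrib, ← Finset.mul_sum, hzero,
    Finset.sum_add_distrib]
  simp

/-- Dyadic addition of indices. -/
def xorIdx (n : ℕ) (i j : Fin (2 ^ n)) : Fin (2 ^ n) :=
  ⟨i.val ^^^ j.val, Nat.xor_lt_two_pow i.isLt j.isLt⟩

lemma xorIdx_xorIdx_cancel_right (n : ℕ) (i j : Fin (2 ^ n)) :
    xorIdx n (xorIdx n i j) j = i := by
  ext
  simp [xorIdx]

/-- Dyadic translation by `l`, as a permutation of the indices. -/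
def xorPerm (n : ℕ) (l : Fin (2 ^ n)) : Equiv.Perm (Fin (2 ^ n)) where
  toFun i := xorIdx n i l
  invFun i := xorIdx n i l
  left_inv i := xorIdx_xorIdx_cancel_right n i l
  right_inv i := xorIdx_xorIdx_cancel_right n i l

/-- The entry of the cyclic translation at row `r XOR l` and column `l`. -/
def shiftEntry (n : ℕ) (r l : Fin (2 ^ n)) : ℂ :=
  if predIdx n (xorIdx n r l) = l then 1 else 0

lemma hsNormSq_shift_sub_dconv (n : ℕ) (g : Fin (2 ^ n) → ℂ) :
    hsNormSq n (fun v => (fun j => v (predIdx n j)) - dconv n g v) =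
      ∑ r, ∑ l, Complex.normSq (shiftEntry n r l - (2 ^ n : ℂ)⁻¹ * g r) := by
  rw [Finset.sum_comm, hsNormSq]
  refine Finset.sum_congr rfl fun l _ => ?_
  have hentry : ∀ j, ((fun j => (Pi.single l 1 : Fin (2 ^ n) → ℂ) (predIdx n j)) -
      dconv n g (Pi.single l 1)) j =
      (if predIdx n j = l then 1 else 0) - (2 ^ n : ℂ)⁻¹ * g (xorIdx n j l) := fun j => by
    simp [dconv, xorIdx, Pi.single_apply]
  have hcast : ((2 : ℂ) ^ n)⁻¹ = (((2 : ℝ) ^ n)⁻¹ : ℝ) := by push_cast; rfl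
  simp only [ninner, hentry, Complex.mul_conj]
  rw [← Complex.ofReal_sum, hcast, ← Complex.ofReal_mul, Complex.ofReal_re,
    mul_inv_cancel_left₀ (by positivity), ← Equiv.sum_comp (xorPerm n l)]
  refine Finset.sum_congr rfl fun r _ => ?_
  simp only [xorPerm, Equiv.coe_fn_mk, xorIdx_xorIdx_cancel_right, shiftEntry]
  rfl

lemma eq_sum_shiftEntry_of_isMin (n : ℕ) (f : Fin (2 ^ n) → ℂ)
    (hf : ∀ g : Fin (2 ^ n) → ℂ,
      hsNormSq n (fun v => (fun j => v (predIdx n j)) - dconv n f v)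
        ≤ hsNormSq n (fun v => (fun j => v (predIdx n j)) - dconv n g v)) (r : Fin (2 ^ n)) :
    f r = ∑ l, shiftEntry n r l := by
  have hmean : ∀ r, (Fintype.card (Fin (2 ^ n)) : ℂ) *
      ((2 ^ n : ℂ)⁻¹ * ∑ l, shiftEntry n r l) = ∑ l, shiftEntry n r l := fun r => by
    simp
  have hle := hf fun r => ∑ l, shiftEntry n r l
  rw [hsNormSq_shift_sub_dconv, hsNormSq_shift_sub_dconv] at hle
  simp only [fun r => sum_normSq_sub (shiftEntry n r) ((2 ^ n : ℂ)⁻¹ * f r) _ (hmean r),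
    Finset.sum_add_distrib, add_le_iff_nonpos_right] at hle
  have hnonneg : ∀ r ∈ Finset.univ, 0 ≤ (Fintype.card (Fin (2 ^ n)) : ℝ) * Complex.normSq
      ((2 ^ n : ℂ)⁻¹ * f r - (2 ^ n : ℂ)⁻¹ * ∑ l, shiftEntry n r l) := fun r _ =>
    mul_nonneg (Nat.cast_nonneg _) (Complex.normSq_nonneg _)
  have hr := (Finset.sum_eq_zero_iff_of_nonneg hnonneg).1
    (le_antisymm hle (Finset.sum_nonneg hnonneg)) r (Finset.mem_univ r)
  simpa [← mul_sub, sub_eq_zero] using hr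

lemma sum_predIdx_eq_shiftCorr (n k : ℕ) :
    ∑ j : Fin (2 ^ n), walshSign n k (predIdx n j) * walshSign n k j = shiftCorr n k := by
  rw [shiftCorr, Finset.sum_range]
  refine Finset.sum_congr rfl fun j _ => ?_
  rw [predIdx, Nat.add_sub_assoc (Nat.one_le_two_pow)]

lemma sum_shiftEntry_mul_walshSign (n k : ℕ) :
    ∑ r : Fin (2 ^ n), (∑ l, shiftEntry n r l) * (walshSign n k r : ℂ) =
      (shiftCorr n k : ℂ) := by
  have hcol : ∀ l : Fin (2 ^ n), ∑ r, shiftEntry n r l * (walshSign n k r : ℂ) =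
      ∑ j, if predIdx n j = l then (walshSign n k l * walshSign n k j : ℂ) else 0 := fun l => by
    rw [← Equiv.sum_comp (xorPerm n l)]
    refine Finset.sum_congr rfl fun j _ => ?_
    simp only [xorPerm, Equiv.coe_fn_mk, shiftEntry, xorIdx_xorIdx_cancel_right]
    rw [xorIdx, walshSign_xor, Complex.ofReal_mul, ite_mul, one_mul, zero_mul, mul_comm]
  simp only [Finset.sum_mul]
  rw [Finset.sum_comm, Finset.sum_congr rfl fun l _ => hcol l, Finset.sum_comm,
    ← sum_predIdx_eq_shiftCorr]
  simp

/-- for `n ≥ 1` and `m < 2^n`, with `k = Gm` and `m_0 = m mod 2`, the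
diagonal Walsh entry of the cyclic translation `T_{2^{-n}}` is
`2^{-n} Σ_j w_k((j-1 mod 2^n)/2^n)·w_k(j/2^n) = 1 - 2^{-n+1}(m + m_0)`; consequently
the best HS-approximation of `T_{2^{-n}}` by a dyadic convolution operator `C_f`
has Walsh coefficients `f^∼(Gm) = 1 - 2^{-n+1}(m + m_0)` for all `m < 2^n`. -/
theorem best_approx_translation (n : ℕ) (hn : 1 ≤ n) :
    (∀ m < 2 ^ n,
      (2 ^ n : ℝ)⁻¹ * ∑ j ∈ Finset.range (2 ^ n),
          walsh (grayCode m) ((((j + 2 ^ n - 1) % 2 ^ n : ℕ) : ℝ) / 2 ^ n) *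
            walsh (grayCode m) ((j : ℝ) / 2 ^ n)
        = 1 - (2 : ℝ) ^ ((1 : ℤ) - (n : ℤ)) * ((m : ℝ) + ((m % 2 : ℕ) : ℝ))) ∧
    (∀ f : Fin (2 ^ n) → ℂ,
      (∀ g : Fin (2 ^ n) → ℂ,
          hsNormSq n (fun v => (fun j => v (predIdx n j)) - dconv n f v)
            ≤ hsNormSq n (fun v => (fun j => v (predIdx n j)) - dconv n g v)) →
      ∀ m < 2 ^ n, walshCoeff n f (grayCode m)
        = 1 - (2 : ℂ) ^ ((1 : ℤ) - (n : ℤ)) * ((m : ℂ) + ((m % 2 : ℕ) : ℂ))) := by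
  have hscale : (2 : ℝ) ^ ((1 : ℤ) - (n : ℤ)) = (2 ^ n : ℝ)⁻¹ * 2 := by
    rw [zpow_sub₀ two_ne_zero, zpow_one, zpow_natCast, div_eq_mul_inv, mul_comm]
  have hentry : ∀ m < 2 ^ n, (2 ^ n : ℝ)⁻¹ * shiftCorr n (grayCode m) =
      1 - (2 : ℝ) ^ ((1 : ℤ) - (n : ℤ)) * ((m : ℝ) + ((m % 2 : ℕ) : ℝ)) := fun m hm => by
    rw [shiftCorr_grayCode n m hm, hscale, mul_sub, inv_mul_cancel₀ (by positivity), mul_assoc]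
  refine ⟨fun m hm => ?_, fun f hf m hm => ?_⟩
  · rw [← hentry m hm]
    simp only [walsh_div_two_pow (grayCode_lt hm), shiftCorr]
  · simp only [walshCoeff, walsh_div_two_pow (grayCode_lt hm), eq_sum_shiftEntry_of_isMin n f hf,
      sum_shiftEntry_mul_walshSign]
    have h := congrArg (Complex.ofReal) (hentry m hm)
    push_cast at h ⊢
    exact h
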